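/- Fix n ≥ 1 and c ∈ [0,1) with cn ∈ ℕ. Let P ∈ (ℝ²)ⁿ be a profile with a minimizer o(P) = (x_o, y_o) of C^u(·, P) satisfying y_o ≥ x_o > 0, such that CMP(P, o(P), c) = (0,0), every point of P lies on the x-axis, on the y-axis, or at o(P), and either |{i : p_i = (t,0) with t < 0}| ≥ |{i : p_i = (t,0) with t > 0}| + |{i : p_i = o(P)}| or |{i : p_i = (0,t) with t < 0}| ≥ |{i : p_i = (0,t) with t > 0}| + |{i : p_i = o(P)}| (counting with multiplicity). Then there exists a profile Q of n points and a minimizer o(Q) of C^u(·, Q) such that C^u(CMP(Q, o(Q), c), Q) / C^u(o(Q), Q) > C^u(CMP(P, o(P), c), P) / C^u(o(P), P). Moreover, if instead CMP(P, (0,0), c) = (0,0) (with the other hypotheses unchanged), there exists a profile Q of n points with C^u(CMP(Q, (0,0), c), Q) / OPT^u(Q) > C^u(CMP(P, (0,0), c), P) / OPT^u(P). -/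

import Mathlib

/-- Euclidean distance on the plane. -/
noncomputable def eudist (a b : ℝ × ℝ) : ℝ :=
  Real.sqrt ((a.1 - b.1) ^ 2 + (a.2 - b.2) ^ 2)

/-- Utilitarian social cost: the average distance from `y` to the points of `P`. -/
noncomputable def Cu {n : ℕ} (y : ℝ × ℝ) (P : Fin n → ℝ × ℝ) : ℝ :=
  (∑ i, eudist y (P i)) / n

/-- The lower median of a multiset of `m` reals: its `⌈m/2⌉`-th smallest element. -/
noncomputable def lowerMedian (s : Multiset ℝ) : ℝ :=
  (s.sort (· ≤ ·)).getD ((s.card + 1) / 2 - 1) 0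

/-- The Coordinatewise Median with Predictions mechanism: the coordinatewise
lower median of the reported points together with `k` copies of the
prediction (where `k = c·n` for confidence `c`). -/
noncomputable def CMP {n : ℕ} (P : Fin n → ℝ × ℝ) (oh : ℝ × ℝ) (k : ℕ) : ℝ × ℝ :=
  (lowerMedian ((↑(List.ofFn fun i => (P i).1) : Multiset ℝ) + Multiset.replicate k oh.1),
   lowerMedian ((↑(List.ofFn fun i => (P i).2) : Multiset ℝ) + Multiset.replicate k oh.2))

lemma eudist_eq_dist (a b : ℝ × ℝ) : eudist a b = dist (⟨a.1, a.2⟩ : ℂ) ⟨b.1, b.2⟩ := by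
  rw [Complex.dist_eq_re_im]; rfl

lemma eudist_nonneg (a b : ℝ × ℝ) : 0 ≤ eudist a b := Real.sqrt_nonneg _

lemma eudist_comm (a b : ℝ × ℝ) : eudist a b = eudist b a := by
  simp only [eudist_eq_dist, dist_comm]

lemma eudist_triangle (a b c : ℝ × ℝ) : eudist a c ≤ eudist a b + eudist b c := by
  simp only [eudist_eq_dist]; exact dist_triangle _ _ _

lemma eudist_eq_zero {a b : ℝ × ℝ} : eudist a b = 0 ↔ a = b := by
  rw [eudist_eq_dist, dist_eq_zero, Complex.mk.injEq, Prod.ext_iff]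

lemma eudist_pos {a b : ℝ × ℝ} (h : a ≠ b) : 0 < eudist a b :=
  (eudist_nonneg a b).lt_of_ne fun h' => h (eudist_eq_zero.1 h'.symm)

lemma eudist_swap (a b : ℝ × ℝ) : eudist a.swap b.swap = eudist a b := by
  simp only [eudist, Prod.fst_swap, Prod.snd_swap, add_comm]

/-- Equality in the triangle inequality for a midpoint forces collinearity. -/
lemma collinear_of_midpoint_eudist (a b p : ℝ × ℝ)
    (h : eudist a p + eudist b p ≤ 2 * eudist ((a.1 + b.1) / 2, (a.2 + b.2) / 2) p) :
    (p.1 - a.1) * (b.2 - a.2) = (p.2 - a.2) * (b.1 - a.1) := by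
  have ha := eudist_nonneg a p
  have hb := eudist_nonneg b p
  have ha2 : eudist a p ^ 2 = (a.1 - p.1) ^ 2 + (a.2 - p.2) ^ 2 := Real.sq_sqrt (by positivity)
  have hb2 : eudist b p ^ 2 = (b.1 - p.1) ^ 2 + (b.2 - p.2) ^ 2 := Real.sq_sqrt (by positivity)
  have hm2 : eudist ((a.1 + b.1) / 2, (a.2 + b.2) / 2) p ^ 2
      = ((a.1 + b.1) / 2 - p.1) ^ 2 + ((a.2 + b.2) / 2 - p.2) ^ 2 := Real.sq_sqrt (by positivity)
  have hsq := pow_le_pow_left₀ (add_nonneg ha hb) h 2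
  have hdot : eudist a p * eudist b p
      ≤ (a.1 - p.1) * (b.1 - p.1) + (a.2 - p.2) * (b.2 - p.2) := by nlinarith
  have hprod := pow_le_pow_left₀ (mul_nonneg ha hb) hdot 2
  rw [mul_pow, ha2, hb2] at hprod
  have : ((p.1 - a.1) * (b.2 - a.2) - (p.2 - a.2) * (b.1 - a.1)) ^ 2 ≤ 0 := by linarith
  have := pow_eq_zero_iff (two_ne_zero) |>.1 (le_antisymm this (sq_nonneg _))
  linarith

lemma eudist_midpoint_le (a b p : ℝ × ℝ) :
    2 * eudist ((a.1 + b.1) / 2, (a.2 + b.2) / 2) p ≤ eudist a p + eudist b p := by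
  have h (u w : ℝ × ℝ) : eudist u w = ‖(⟨u.1, u.2⟩ - ⟨w.1, w.2⟩ : ℂ)‖ := by
    rw [eudist_eq_dist, dist_eq_norm]
  have h2 : (2 : ℝ) = ‖(2 : ℂ)‖ := by simp
  rw [h, h, h, h2, ← norm_mul]
  refine le_trans (le_of_eq ?_) (norm_add_le _ _)
  congr 1
  apply Complex.ext <;> simp <;> ring

lemma eudist_add_of_mem_segment (a b : ℝ × ℝ) {s : ℝ} (hs0 : 0 ≤ s) (hs1 : s ≤ 1) :
    eudist a (b.1 + s * (a.1 - b.1), b.2 + s * (a.2 - b.2)) +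
      eudist (b.1 + s * (a.1 - b.1), b.2 + s * (a.2 - b.2)) b = eudist a b := by
  have h1 : eudist a (b.1 + s * (a.1 - b.1), b.2 + s * (a.2 - b.2)) = (1 - s) * eudist a b := by
    unfold eudist
    rw [← Real.sqrt_sq (sub_nonneg.2 hs1), ← Real.sqrt_mul (sq_nonneg _)]
    ring_nf
  have h2 : eudist (b.1 + s * (a.1 - b.1), b.2 + s * (a.2 - b.2)) b = s * eudist a b := by
    unfold eudist
    conv_rhs => rw [← Real.sqrt_sq hs0, ← Real.sqrt_mul (sq_nonneg _)]
    ring_nf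
  rw [h1, h2]
  ring

section Cost

variable {n : ℕ}

lemma Cu_swap (y : ℝ × ℝ) (P : Fin n → ℝ × ℝ) : Cu y.swap (fun i => (P i).swap) = Cu y P := by
  simp only [Cu, eudist_swap]

lemma continuous_Cu (P : Fin n → ℝ × ℝ) : Continuous fun y => Cu y P := by
  unfold Cu eudist
  fun_prop

lemma Cu_le_Cu {y z : ℝ × ℝ} {P Q : Fin n → ℝ × ℝ} (h : ∀ i, eudist y (P i) ≤ eudist z (Q i)) :
    Cu y P ≤ Cu z Q :=
  div_le_div_of_nonneg_right (Finset.sum_le_sum fun i _ => h i) n.cast_nonneg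

lemma Cu_lt_Cu {y z : ℝ × ℝ} {P Q : Fin n → ℝ × ℝ} (h : ∀ i, eudist y (P i) ≤ eudist z (Q i))
    (h' : ∃ i, eudist y (P i) < eudist z (Q i)) : Cu y P < Cu z Q := by
  obtain ⟨i, hi⟩ := h'
  have hn : (0 : ℝ) < n := Nat.cast_pos.2 i.pos
  exact div_lt_div_of_pos_right
    (Finset.sum_lt_sum (fun i _ => h i) ⟨i, Finset.mem_univ i, hi⟩) hn

lemma Cu_pos {y : ℝ × ℝ} {P : Fin n → ℝ × ℝ} (h : ∃ i, P i ≠ y) : 0 < Cu y P := by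
  obtain ⟨i, hi⟩ := h
  have hn : (0 : ℝ) < n := Nat.cast_pos.2 i.pos
  exact div_pos (Finset.sum_pos' (fun _ _ => eudist_nonneg _ _)
    ⟨i, Finset.mem_univ i, eudist_pos hi.symm⟩) hn

lemma Cu_le_add (hn : 1 ≤ n) {y : ℝ × ℝ} {P Q : Fin n → ℝ × ℝ} {r : ℝ}
    (h : ∀ i, eudist y (P i) ≤ eudist y (Q i) + r) : Cu y P ≤ Cu y Q + r := by
  have hn' : (0 : ℝ) < n := Nat.cast_pos.2 hn
  have := Finset.sum_le_sum fun i (_ : i ∈ Finset.univ) => h i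
  rw [Finset.sum_add_distrib, Finset.sum_const, Finset.card_univ, Fintype.card_fin,
    nsmul_eq_mul] at this
  unfold Cu
  rw [div_add' _ _ _ hn'.ne']
  exact div_le_div_of_nonneg_right (by linarith) hn'.le

lemma tendsto_Cu_cocompact (hn : 1 ≤ n) (P : Fin n → ℝ × ℝ) :
    Filter.Tendsto (fun y => Cu y P) (Filter.cocompact (ℝ × ℝ)) Filter.atTop := by
  have h (y : ℝ × ℝ) : ‖y‖ + -Cu (0, 0) P ≤ Cu y P := by
    have h1 : ‖y‖ ≤ eudist y (0, 0) := by
      rw [Prod.norm_def]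
      refine max_le ?_ ?_ <;> refine Real.abs_le_sqrt ?_ <;> simp <;> positivity
    have hn' : (0 : ℝ) < n := Nat.cast_pos.2 hn
    unfold Cu
    rw [← sub_eq_add_neg, sub_le_iff_le_add, ← add_div, le_div_iff₀ hn', ← Finset.sum_add_distrib]
    have := Finset.sum_le_sum fun i (_ : i ∈ (Finset.univ : Finset (Fin n))) =>
      h1.trans (eudist_triangle y (P i) (0, 0))
    rw [Finset.sum_const, Finset.card_univ, Fintype.card_fin, nsmul_eq_mul] at this
    simp only [eudist_comm (0, 0)]
    linarith
  exact Filter.tendsto_atTop_mono h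
    (Filter.tendsto_atTop_add_const_right _ _ (tendsto_norm_cocompact_atTop))

lemma exists_minimizer (hn : 1 ≤ n) (P : Fin n → ℝ × ℝ) : ∃ o, ∀ y, Cu o P ≤ Cu y P :=
  (continuous_Cu P).exists_forall_le (tendsto_Cu_cocompact hn P)

lemma exists_minimizer_on (hn : 1 ≤ n) (P : Fin n → ℝ × ℝ) {s : Set (ℝ × ℝ)} (hs : IsClosed s)
    (hne : s.Nonempty) : ∃ o ∈ s, ∀ y ∈ s, Cu o P ≤ Cu y P := by
  obtain ⟨x₀, h₀⟩ := hne
  exact (continuous_Cu P).continuousOn.exists_isMinOn' hs h₀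
    ((tendsto_Cu_cocompact hn P).eventually_ge_atTop _ |>.filter_mono inf_le_left)

lemma collinear_of_two_minimizers {P : Fin n → ℝ × ℝ} {a b : ℝ × ℝ}
    (ha : ∀ y, Cu a P ≤ Cu y P) (hb : ∀ y, Cu b P ≤ Cu y P) (i : Fin n) :
    ((P i).1 - a.1) * (b.2 - a.2) = ((P i).2 - a.2) * (b.1 - a.1) := by
  apply collinear_of_midpoint_eudist
  by_contra! h
  have hn : (0 : ℝ) < n := Nat.cast_pos.2 i.pos
  have hlt := Finset.sum_lt_sum (fun j _ => eudist_midpoint_le a b (P j)) ⟨i, Finset.mem_univ i, h⟩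
  rw [← Finset.mul_sum, Finset.sum_add_distrib] at hlt
  have h1 := (div_le_div_iff_of_pos_right hn).1 (ha ((a.1 + b.1) / 2, (a.2 + b.2) / 2))
  have h2 := (div_le_div_iff_of_pos_right hn).1 (hb ((a.1 + b.1) / 2, (a.2 + b.2) / 2))
  linarith

end Cost

section Median

lemma Real.monotone_sign : Monotone Real.sign := by
  intro a b h
  rcases lt_trichotomy a 0 with ha | rfl | ha <;> rcases lt_trichotomy b 0 with hb | rfl | hb <;>
    simp_all [Real.sign_of_neg, Real.sign_of_pos] <;> linarith

lemma lowerMedian_map {f : ℝ → ℝ} (hf : Monotone f) (h0 : f 0 = 0) (s : Multiset ℝ) :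
    lowerMedian (s.map f) = f (lowerMedian s) := by
  have : (s.map f).sort (· ≤ ·) = (s.sort (· ≤ ·)).map f := by
    refine List.Perm.eq_of_pairwise' ?_ ?_ ?_ (r := (· ≤ ·))
    · exact Multiset.pairwise_sort _ _
    · exact (Multiset.pairwise_sort s _).map f fun _ _ h => hf h
    · rw [← Multiset.coe_eq_coe, Multiset.sort_eq, ← Multiset.map_coe, Multiset.sort_eq]
  unfold lowerMedian
  rw [this, Multiset.card_map]
  conv_lhs => rw [← h0]
  rw [List.getD_map]

lemma lowerMedian_eq_zero_iff_sign (s : Multiset ℝ) :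
    lowerMedian s = 0 ↔ lowerMedian (s.map Real.sign) = 0 := by
  rw [lowerMedian_map Real.monotone_sign Real.sign_zero, Real.sign_eq_zero_iff]

lemma lowerMedian_mem {s : Multiset ℝ} (h : 0 < s.card) : lowerMedian s ∈ s := by
  have hlt : (s.card + 1) / 2 - 1 < (s.sort (· ≤ ·)).length := by
    rw [Multiset.length_sort]; omega
  unfold lowerMedian
  rw [List.getD_eq_getElem _ _ hlt, ← Multiset.mem_sort (r := (· ≤ ·))]
  exact List.getElem_mem hlt

variable {n k : ℕ}

lemma lowerMedian_eq_zero_of_sign_eq {x x' : Fin n → ℝ} {z z' : ℝ}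
    (hx : ∀ i, Real.sign (x' i) = Real.sign (x i)) (hz : Real.sign z' = Real.sign z)
    (h : lowerMedian ((↑(List.ofFn x) : Multiset ℝ) + Multiset.replicate k z) = 0) :
    lowerMedian ((↑(List.ofFn x') : Multiset ℝ) + Multiset.replicate k z') = 0 := by
  rw [lowerMedian_eq_zero_iff_sign] at h ⊢
  rw [← h]
  have : Real.sign ∘ x' = Real.sign ∘ x := funext hx
  simp only [Multiset.map_add, Multiset.map_coe, List.map_ofFn, Multiset.map_replicate, hz, this]

lemma exists_eq_zero_of_lowerMedian {x : Fin n → ℝ} {z : ℝ} (hn : 1 ≤ n) (hz : z ≠ 0)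
    (h : lowerMedian ((↑(List.ofFn x) : Multiset ℝ) + Multiset.replicate k z) = 0) :
    ∃ i, x i = 0 := by
  have hmem := lowerMedian_mem
    (s := (↑(List.ofFn x) : Multiset ℝ) + Multiset.replicate k z) (by simp; omega)
  rw [h, Multiset.mem_add, Multiset.mem_coe, List.mem_ofFn] at hmem
  exact hmem.resolve_right fun h' => hz (Multiset.eq_of_mem_replicate h').symm

lemma CMP_eq_zero_of_sign_eq {P Q : Fin n → ℝ × ℝ} {o o' : ℝ × ℝ}
    (h1 : ∀ i, Real.sign (Q i).1 = Real.sign (P i).1)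
    (h2 : ∀ i, Real.sign (Q i).2 = Real.sign (P i).2)
    (ho1 : Real.sign o'.1 = Real.sign o.1) (ho2 : Real.sign o'.2 = Real.sign o.2)
    (h : CMP P o k = (0, 0)) : CMP Q o' k = (0, 0) := by
  rw [CMP, Prod.mk.injEq] at h ⊢
  exact ⟨lowerMedian_eq_zero_of_sign_eq h1 ho1 h.1, lowerMedian_eq_zero_of_sign_eq h2 ho2 h.2⟩

lemma CMP_swap (P : Fin n → ℝ × ℝ) (o : ℝ × ℝ) :
    CMP (fun i => (P i).swap) o.swap k = (CMP P o k).swap := rfl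

end Median

/-- Balance of a point on the first axis: `1` on its negative half, `-1` on its positive half,
and `-1` at `o`. -/
noncomputable def axisWeight (o p : ℝ × ℝ) : ℝ :=
  (if p.2 = 0 ∧ p.1 < 0 then 1 else 0) -
    ((if p.2 = 0 ∧ 0 < p.1 then 1 else 0) + (if p = o then 1 else 0))

/-- Translate by `-ε` along the first axis the points that are not on the second axis. -/
noncomputable def shiftOffAxis {n : ℕ} (ε : ℝ) (P : Fin n → ℝ × ℝ) (i : Fin n) : ℝ × ℝ :=
  if (P i).1 = 0 then P i else ((P i).1 - ε, (P i).2)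

section Shift

variable {n : ℕ} {P : Fin n → ℝ × ℝ} {o : ℝ × ℝ} {ε : ℝ}

lemma sum_axisWeight_nonneg
    (h : Nat.card {i : Fin n // (P i).2 = 0 ∧ (P i).1 < 0} ≥
      Nat.card {i : Fin n // (P i).2 = 0 ∧ 0 < (P i).1} + Nat.card {i : Fin n // P i = o}) :
    0 ≤ ∑ i, axisWeight o (P i) := by
  simp only [Nat.card_eq_fintype_card, Fintype.card_subtype] at h
  simp only [axisWeight, Finset.sum_sub_distrib, Finset.sum_add_distrib, Finset.sum_boole]
  rw [sub_nonneg]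
  exact_mod_cast h

lemma sign_shiftOffAxis_fst (hε : 0 < ε) (hP : ∀ i, 0 < (P i).1 → ε < (P i).1) (i : Fin n) :
    Real.sign (shiftOffAxis ε P i).1 = Real.sign (P i).1 := by
  unfold shiftOffAxis
  split_ifs with h
  · rfl
  rcases lt_or_gt_of_ne h with h | h
  · rw [Real.sign_of_neg h, Real.sign_of_neg (by simp only; linarith)]
  · rw [Real.sign_of_pos h, Real.sign_of_pos (by have := hP i h; simp only; linarith)]

lemma shiftOffAxis_snd (i : Fin n) : (shiftOffAxis ε P i).2 = (P i).2 := by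
  unfold shiftOffAxis
  split_ifs <;> rfl

lemma eudist_shiftOffAxis_le (hε : 0 < ε) (i : Fin n) : eudist (shiftOffAxis ε P i) (P i) ≤ ε := by
  unfold shiftOffAxis eudist
  split_ifs
  · simpa using hε.le
  · simp [Real.sqrt_sq hε.le]

lemma Cu_le_Cu_shiftOffAxis_add (hn : 1 ≤ n) (hε : 0 < ε) (y : ℝ × ℝ) :
    Cu y P ≤ Cu y (shiftOffAxis ε P) + ε :=
  Cu_le_add hn fun i => (eudist_triangle _ _ _).trans
    (add_le_add_right (eudist_shiftOffAxis_le hε i) _)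

lemma Cu_shiftOffAxis_le_Cu_add (hn : 1 ≤ n) (hε : 0 < ε) (y : ℝ × ℝ) :
    Cu y (shiftOffAxis ε P) ≤ Cu y P + ε :=
  Cu_le_add hn fun i => (eudist_triangle _ _ _).trans
    (add_le_add_right ((eudist_comm _ _).trans_le (eudist_shiftOffAxis_le hε i)) _)

lemma eudist_translate_le (hε : 0 < ε) (hεo : ε < o.1) (i : Fin n) :
    eudist (o.1 - ε, o.2) (shiftOffAxis ε P i) ≤ eudist o (P i) := by
  unfold shiftOffAxis eudist
  split_ifs with h
  · refine Real.sqrt_le_sqrt ?_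
    simp only [h]
    nlinarith
  · simp

lemma eudist_translate_lt (hε : 0 < ε) (hεo : ε < o.1) {i : Fin n} (h : (P i).1 = 0) :
    eudist (o.1 - ε, o.2) (shiftOffAxis ε P i) < eudist o (P i) := by
  unfold shiftOffAxis eudist
  rw [if_pos h]
  refine Real.sqrt_lt_sqrt (by positivity) ?_
  simp only [h]
  nlinarith

lemma eudist_zero_of_snd_eq_zero {p : ℝ × ℝ} (h : p.2 = 0) : eudist (0, 0) p = |p.1| := by
  simp [eudist, h, Real.sqrt_sq_eq_abs]

lemma eudist_lt_of_shift {p : ℝ × ℝ} (hε : 0 < ε) (hp : p.2 ≠ 0) :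
    eudist (0, 0) p < eudist (0, 0) (p.1 - ε, p.2) + ε := by
  have h0 : 0 < eudist (0, 0) (p.1 - ε, p.2) := eudist_pos fun h => hp (Prod.ext_iff.1 h).2.symm
  refine lt_of_pow_lt_pow_left₀ 2 (by positivity) ?_
  have h1 : eudist (0, 0) p ^ 2 = (0 - p.1) ^ 2 + (0 - p.2) ^ 2 := Real.sq_sqrt (by positivity)
  have h2 : eudist (0, 0) (p.1 - ε, p.2) ^ 2 = (0 - (p.1 - ε)) ^ 2 + (0 - p.2) ^ 2 :=
    Real.sq_sqrt (by positivity)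
  have h3 : p.1 - ε < eudist (0, 0) (p.1 - ε, p.2) := by
    have hp2 : 0 < p.2 ^ 2 := by positivity
    by_contra! h
    nlinarith
  nlinarith

lemma eudist_add_weight_le (ho1 : 0 < o.1) (ho2 : 0 < o.2) (hε : 0 < ε)
    (hP : ∀ i, 0 < (P i).1 → ε < (P i).1)
    (hall : ∀ i, (P i).2 = 0 ∨ (P i).1 = 0 ∨ P i = o) (i : Fin n) :
    eudist (0, 0) (P i) + ε * axisWeight o (P i) ≤ eudist (0, 0) (shiftOffAxis ε P i) := by
  by_cases hi : P i = o
  · have := eudist_lt_of_shift (p := o) hε ho2.ne'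
    simp only [axisWeight, shiftOffAxis, hi, ho1.ne', ho2.ne', if_false, if_true, false_and]
    linarith
  by_cases hx : (P i).1 = 0
  · simp [axisWeight, shiftOffAxis, hi, hx]
  have hy : (P i).2 = 0 := by have := hall i; tauto
  rw [eudist_zero_of_snd_eq_zero hy, eudist_zero_of_snd_eq_zero ((shiftOffAxis_snd i).trans hy)]
  simp only [axisWeight, shiftOffAxis, hi, hx, hy, true_and, if_false]
  rcases lt_or_gt_of_ne hx with h | h
  · rw [abs_of_neg h, abs_of_neg (by linarith), if_pos h, if_neg h.not_gt]
    linarith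
  · have := hP i h
    rw [abs_of_pos h, abs_of_pos (by linarith), if_neg h.not_gt, if_pos h]
    linarith

lemma eudist_add_weight_lt (ho1 : 0 < o.1) (ho2 : 0 < o.2) (hε : 0 < ε) {i : Fin n}
    (hi : P i = o) :
    eudist (0, 0) (P i) + ε * axisWeight o (P i) < eudist (0, 0) (shiftOffAxis ε P i) := by
  have := eudist_lt_of_shift (p := o) hε ho2.ne'
  simp only [axisWeight, shiftOffAxis, hi, ho1.ne', ho2.ne', if_false, if_true, false_and]
  linarith

lemma Cu_zero_le_Cu_zero_shiftOffAxis (ho1 : 0 < o.1) (ho2 : 0 < o.2) (hε : 0 < ε)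
    (hP : ∀ i, 0 < (P i).1 → ε < (P i).1)
    (hall : ∀ i, (P i).2 = 0 ∨ (P i).1 = 0 ∨ P i = o) (hw : 0 ≤ ∑ i, axisWeight o (P i)) :
    Cu (0, 0) P ≤ Cu (0, 0) (shiftOffAxis ε P) := by
  have := Finset.sum_le_sum fun i (_ : i ∈ Finset.univ) =>
    eudist_add_weight_le ho1 ho2 hε hP hall i
  rw [Finset.sum_add_distrib, ← Finset.mul_sum] at this
  refine div_le_div_of_nonneg_right ?_ n.cast_nonneg
  nlinarith

lemma Cu_zero_lt_Cu_zero_shiftOffAxis (ho1 : 0 < o.1) (ho2 : 0 < o.2) (hε : 0 < ε)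
    (hP : ∀ i, 0 < (P i).1 → ε < (P i).1)
    (hall : ∀ i, (P i).2 = 0 ∨ (P i).1 = 0 ∨ P i = o) (hw : 0 ≤ ∑ i, axisWeight o (P i))
    (h : ∃ i, P i = o) :
    Cu (0, 0) P < Cu (0, 0) (shiftOffAxis ε P) := by
  obtain ⟨i, hi⟩ := h
  have := Finset.sum_lt_sum (fun i _ => eudist_add_weight_le ho1 ho2 hε hP hall i)
    ⟨i, Finset.mem_univ i, eudist_add_weight_lt ho1 ho2 hε hi⟩
  rw [Finset.sum_add_distrib, ← Finset.mul_sum] at this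
  refine div_lt_div_of_pos_right ?_ (Nat.cast_pos.2 i.pos)
  nlinarith

end Shift

section Worst

variable {n : ℕ} {P : Fin n → ℝ × ℝ} {o : ℝ × ℝ}

lemma Cu_minimizer_pos (hn : 1 ≤ n) (ho2 : 0 < o.2) (hw : 0 ≤ ∑ i, axisWeight o (P i)) :
    0 < Cu o P := by
  apply Cu_pos
  by_contra! h
  have : (0 : ℝ) < n := Nat.cast_pos.2 hn
  simp [axisWeight, h, ho2.ne'] at hw
  linarith

lemma exists_fst_eq_zero_or_eq (hn : 1 ≤ n) (ho2 : 0 < o.2) (ho : ∀ y, Cu o P ≤ Cu y P)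
    (hall : ∀ i, (P i).2 = 0 ∨ (P i).1 = 0 ∨ P i = o) :
    (∃ i, (P i).1 = 0) ∨ ∃ i, P i = o := by
  by_contra! h
  have hy (i : Fin n) : (P i).2 = 0 := by
    have := hall i
    have := h.1 i
    have := h.2 i
    tauto
  have hlt (i : Fin n) : eudist (o.1, 0) (P i) < eudist o (P i) := by
    refine Real.sqrt_lt_sqrt (by positivity) ?_
    simp only [hy]
    nlinarith
  exact (ho (o.1, 0)).not_gt (Cu_lt_Cu (fun i => (hlt i).le) ⟨⟨0, hn⟩, hlt _⟩)

lemma ratio_lt_ratio_shiftOffAxis (hn : 1 ≤ n) (ho1 : 0 < o.1) (ho2 : 0 < o.2)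
    (ho : ∀ y, Cu o P ≤ Cu y P) (hall : ∀ i, (P i).2 = 0 ∨ (P i).1 = 0 ∨ P i = o)
    (hw : 0 ≤ ∑ i, axisWeight o (P i)) {ε : ℝ} (hε : 0 < ε)
    (hP : ∀ i, 0 < (P i).1 → ε < (P i).1) (hεo : ε < o.1) (hεC : ε < Cu o P) {q : ℝ × ℝ}
    (hq : ∀ y, Cu q (shiftOffAxis ε P) ≤ Cu y (shiftOffAxis ε P)) :
    Cu (0, 0) P / Cu o P < Cu (0, 0) (shiftOffAxis ε P) / Cu q (shiftOffAxis ε P) := by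
  have hoP := Cu_minimizer_pos hn ho2 hw
  have h0P : 0 < Cu (0, 0) P := hoP.trans_le (ho _)
  have hqQ : 0 < Cu q (shiftOffAxis ε P) := by
    linarith [Cu_le_Cu_shiftOffAxis_add (P := P) hn hε q, ho q]
  have hnum := Cu_zero_le_Cu_zero_shiftOffAxis ho1 ho2 hε hP hall hw
  have hden : Cu q (shiftOffAxis ε P) ≤ Cu o P :=
    (hq (o.1 - ε, o.2)).trans (Cu_le_Cu (eudist_translate_le hε hεo))
  rcases exists_fst_eq_zero_or_eq hn ho2 ho hall with ⟨i, hi⟩ | h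
  · have hden' : Cu q (shiftOffAxis ε P) < Cu o P := (hq (o.1 - ε, o.2)).trans_lt
      (Cu_lt_Cu (eudist_translate_le hε hεo) ⟨i, eudist_translate_lt hε hεo hi⟩)
    exact (div_lt_div_of_pos_left h0P hqQ hden').trans_le (div_le_div_of_nonneg_right hnum hqQ.le)
  · have hnum' := Cu_zero_lt_Cu_zero_shiftOffAxis ho1 ho2 hε hP hall hw h
    exact (div_le_div_of_nonneg_left h0P.le hqQ hden).trans_lt
      (div_lt_div_of_pos_right hnum' hqQ)

lemma minimizer_unique (ho1 : 0 < o.1) (ho2 : 0 < o.2)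
    (ho : ∀ y, Cu o P ≤ Cu y P) (hall : ∀ i, (P i).2 = 0 ∨ (P i).1 = 0 ∨ P i = o)
    (hw : 0 ≤ ∑ i, axisWeight o (P i)) (hx : ∃ i, (P i).1 = 0) (hy : ∃ i, (P i).2 = 0)
    {q : ℝ × ℝ} (hq : ∀ y, Cu q P ≤ Cu y P) : q = o := by
  by_contra hne
  have hcol := collinear_of_two_minimizers ho hq
  obtain ⟨j, hj⟩ := hx
  obtain ⟨l, hl⟩ := hy
  have hv1 : q.1 - o.1 ≠ 0 := by
    intro h
    have := hcol j
    rw [hj, h, mul_zero, mul_eq_zero] at this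
    rcases this with h' | h'
    · linarith
    · exact hne (Prod.ext (by linarith) (by linarith))
  have hv2 : q.2 - o.2 ≠ 0 := by
    intro h
    have := hcol l
    rw [hl, h, mul_zero, eq_comm, mul_eq_zero] at this
    rcases this with h' | h'
    · linarith
    · exact hv1 h'
  have hxa (i : Fin n) (hi : (P i).2 = 0) : (P i).1 = (P l).1 := by
    have h1 := hcol i
    rw [hi, ← hl, ← hcol l] at h1
    linarith [mul_right_cancel₀ hv2 h1]
  have hyb (i : Fin n) (hi : (P i).1 = 0) : P i = P j := by
    have h1 := hcol i
    rw [hi, ← hj, hcol j] at h1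
    exact Prod.ext (hi.trans hj.symm) (by linarith [mul_right_cancel₀ hv1 h1])
  have hlo : P l ≠ o := fun h => ho2.ne' (h ▸ hl)
  have hjo : P j ≠ o := fun h => ho1.ne' (h ▸ hj)
  rcases lt_or_ge (P l).1 0 with ha | ha
  · set D := eudist o (P j) with hD
    have hDpos : 0 < D := eudist_pos hjo.symm
    have hpt (i : Fin n) (hi : (P i).2 = 0) : P i = P l := Prod.ext (hxa i hi) (hi.trans hl.symm)
    have hlong : eudist o (P l) = D + eudist (P j) (P l) := by
      obtain ⟨s, hs0, hs1, hs⟩ : ∃ s : ℝ, 0 ≤ s ∧ s ≤ 1 ∧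
          P j = ((P l).1 + s * (o.1 - (P l).1), (P l).2 + s * (o.2 - (P l).2)) := by
        have hd : 0 < o.1 - (P l).1 := by linarith
        refine ⟨-(P l).1 / (o.1 - (P l).1), div_nonneg (by linarith) hd.le,
          (div_le_one hd).2 (by linarith), Prod.ext ?_ ?_⟩
        · simp only [hj]
          field_simp
          ring
        · have h1 := hcol j
          have h2 := hcol l
          rw [hj] at h1
          rw [hl] at h2
          have h3 : (P j).2 * (o.1 - (P l).1) = -(P l).1 * o.2 := by
            apply mul_right_cancel₀ hv1
            linear_combination (-(o.1 - (P l).1)) * h1 + o.1 * h2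
          simp only [hl]
          rw [div_mul_eq_mul_div, eq_comm, zero_add, sub_zero, div_eq_iff hd.ne', h3]
      rw [hD, hs]
      exact (eudist_add_of_mem_segment o (P l) hs0 hs1).symm
    have hle (i : Fin n) :
        eudist (P j) (P i) + D * axisWeight o (P i) ≤ eudist o (P i) := by
      rcases hall i with hi | hi | hi
      · rw [hpt i hi, hlong]
        simp [axisWeight, hl, ha, ha.not_gt, hlo, add_comm]
      · rw [hyb i hi]
        simp [axisWeight, hj, hjo, eudist_eq_zero.2, hDpos.le, D]
      · rw [hi, eudist_comm _ o, eudist_eq_zero.2 rfl]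
        simp [axisWeight, ho2.ne', D]
    have hlt : eudist (P j) (P j) + D * axisWeight o (P j) < eudist o (P j) := by
      simp [axisWeight, hj, hjo, eudist_eq_zero.2, hDpos, ← hD]
    have hsum := Finset.sum_lt_sum (fun i _ => hle i) ⟨j, Finset.mem_univ j, hlt⟩
    rw [Finset.sum_add_distrib, ← Finset.mul_sum] at hsum
    refine (ho (P j)).not_gt (div_lt_div_of_pos_right ?_ (Nat.cast_pos.2 j.pos))
    nlinarith
  · have hw0 (i : Fin n) : axisWeight o (P i) ≤ 0 := by
      unfold axisWeight
      rw [if_neg fun h => by linarith [hxa i h.1]]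
      split_ifs <;> norm_num
    have hz (i : Fin n) : axisWeight o (P i) = 0 :=
      (Finset.sum_eq_zero_iff_of_nonpos fun i _ => hw0 i).1
        (le_antisymm (Finset.sum_nonpos fun i _ => hw0 i) hw) i (Finset.mem_univ i)
    have hno (i : Fin n) : P i ≠ o := by
      intro h
      have := hz i
      simp [axisWeight, h, ho2.ne'] at this
    have hl0 : (P l).1 = 0 := by
      by_contra h
      have hpos := lt_of_le_of_ne ha (Ne.symm h)
      have := hz l
      simp [axisWeight, hl, hpos, hpos.not_gt, hlo] at this
    have hx0 (i : Fin n) : (P i).1 = 0 := by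
      rcases hall i with hi | hi | hi
      · rw [hxa i hi, hl0]
      · exact hi
      · exact absurd hi (hno i)
    have hlt (i : Fin n) : eudist (0, o.2) (P i) < eudist o (P i) := by
      refine Real.sqrt_lt_sqrt (by positivity) ?_
      simp only [hx0]
      nlinarith
    exact (ho (0, o.2)).not_gt (Cu_lt_Cu (fun i => (hlt i).le) ⟨j, hlt _⟩)

lemma exists_worse_profile (hn : 1 ≤ n) (k : ℕ) (ho1 : 0 < o.1) (ho2 : 0 < o.2)
    (ho : ∀ y, Cu o P ≤ Cu y P) (hall : ∀ i, (P i).2 = 0 ∨ (P i).1 = 0 ∨ P i = o)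
    (hw : 0 ≤ ∑ i, axisWeight o (P i)) :
    (CMP P o k = (0, 0) → ∃ (Q : Fin n → ℝ × ℝ) (q : ℝ × ℝ), (∀ y, Cu q Q ≤ Cu y Q) ∧
      CMP Q q k = (0, 0) ∧ Cu (0, 0) P / Cu o P < Cu (0, 0) Q / Cu q Q) ∧
    (CMP P (0, 0) k = (0, 0) → ∃ (Q : Fin n → ℝ × ℝ) (q : ℝ × ℝ), (∀ y, Cu q Q ≤ Cu y Q) ∧
      CMP Q (0, 0) k = (0, 0) ∧ Cu (0, 0) P / Cu o P < Cu (0, 0) Q / Cu q Q) := by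
  have small {δ : ℝ} (hδ : 0 < δ) : ∃ ε, 0 < ε ∧ (∀ i, 0 < (P i).1 → ε < (P i).1) ∧ ε < o.1 ∧
      ε < Cu o P ∧ ε < δ := by
    have lt_of_pos {a : ℝ} (h : 0 < a) : ∀ᶠ ε in nhdsWithin (0 : ℝ) (Set.Ioi 0), ε < a :=
      (eventually_lt_nhds h).filter_mono nhdsWithin_le_nhds
    refine Filter.Eventually.exists (f := nhdsWithin (0 : ℝ) (Set.Ioi 0)) ?_
    exact eventually_mem_nhdsWithin.and <| (Filter.eventually_all.2 fun i => by
      by_cases h : 0 < (P i).1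
      · exact (lt_of_pos h).mono fun _ h _ => h
      · exact Filter.Eventually.of_forall fun _ h' => absurd h' h).and <|
      (lt_of_pos ho1).and <| (lt_of_pos (Cu_minimizer_pos hn ho2 hw)).and (lt_of_pos hδ)
  refine ⟨fun hC => ?_, fun hC => ?_⟩
  · have hC' := hC
    rw [CMP, Prod.mk.injEq] at hC'
    have hx : ∃ i, (P i).1 = 0 := exists_eq_zero_of_lowerMedian hn ho1.ne' hC'.1
    have hy : ∃ i, (P i).2 = 0 := exists_eq_zero_of_lowerMedian hn ho2.ne' hC'.2
    obtain ⟨z, hz, hzmin⟩ := exists_minimizer_on hn P (s := {y | y.1 ≤ 0 ∨ y.2 ≤ 0})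
      ((isClosed_le continuous_fst continuous_const).union
        (isClosed_le continuous_snd continuous_const)) ⟨(0, 0), Or.inl le_rfl⟩
    have hgap : Cu o P < Cu z P := by
      by_contra! h
      have := minimizer_unique ho1 ho2 ho hall hw hx hy fun y => h.trans (ho y)
      rw [this] at hz
      rcases hz with hz | hz <;> linarith
    obtain ⟨ε, hε, hP, hεo, hεC, hεδ⟩ := small (half_pos (sub_pos.2 hgap))
    obtain ⟨q, hq⟩ := exists_minimizer hn (shiftOffAxis ε P)
    have hqpos : 0 < q.1 ∧ 0 < q.2 := by
      by_contra h
      have hqs : q.1 ≤ 0 ∨ q.2 ≤ 0 := by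
        by_contra! h'
        exact h h'
      linarith [hzmin q hqs, hq o, Cu_le_Cu_shiftOffAxis_add (P := P) hn hε q,
        Cu_shiftOffAxis_le_Cu_add (P := P) hn hε o]
    refine ⟨shiftOffAxis ε P, q, hq, ?_,
      ratio_lt_ratio_shiftOffAxis hn ho1 ho2 ho hall hw hε hP hεo hεC hq⟩
    refine CMP_eq_zero_of_sign_eq (sign_shiftOffAxis_fst hε hP)
      (fun i => by rw [shiftOffAxis_snd]) ?_ ?_ hC
    · rw [Real.sign_of_pos hqpos.1, Real.sign_of_pos ho1]
    · rw [Real.sign_of_pos hqpos.2, Real.sign_of_pos ho2]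
  · obtain ⟨ε, hε, hP, hεo, hεC, -⟩ := small one_pos
    obtain ⟨q, hq⟩ := exists_minimizer hn (shiftOffAxis ε P)
    exact ⟨shiftOffAxis ε P, q, hq,
      CMP_eq_zero_of_sign_eq (sign_shiftOffAxis_fst hε hP)
        (fun i => by rw [shiftOffAxis_snd]) rfl rfl hC,
      ratio_lt_ratio_shiftOffAxis hn ho1 ho2 ho hall hw hε hP hεo hεC hq⟩

end Worst

lemma iInf_Cu_eq {n : ℕ} {P : Fin n → ℝ × ℝ} {o : ℝ × ℝ} (ho : ∀ y, Cu o P ≤ Cu y P) :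
    ⨅ y, Cu y P = Cu o P :=
  le_antisymm (ciInf_le ⟨Cu o P, by rintro _ ⟨y, rfl⟩; exact ho y⟩ o) (le_ciInf ho)

/-- if all points lie on the axes or at the optimal location
(which is strictly inside the top-right quadrant, above the diagonal), CMP
outputs the origin, and a weak majority condition holds on one of the axes,
then there is a profile with a strictly worse approximation ratio (both for
correct predictions and for prediction (0,0)). -/
theorem CMP_equal_sizes (n : ℕ) (hn : 1 ≤ n) (c : ℝ) (hc0 : 0 ≤ c) (hc1 : c < 1)
    (k : ℕ) (hk : (k : ℝ) = c * n)
    (P : Fin n → ℝ × ℝ) (xo yo : ℝ) (hxo : 0 < xo) (hxy : xo ≤ yo)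
    (ho : ∀ y : ℝ × ℝ, Cu (xo, yo) P ≤ Cu y P)
    (hall : ∀ i, (P i).2 = 0 ∨ (P i).1 = 0 ∨ P i = (xo, yo))
    (hcount :
      Nat.card {i : Fin n // (P i).2 = 0 ∧ (P i).1 < 0} ≥
        Nat.card {i : Fin n // (P i).2 = 0 ∧ 0 < (P i).1} +
          Nat.card {i : Fin n // P i = (xo, yo)} ∨
      Nat.card {i : Fin n // (P i).1 = 0 ∧ (P i).2 < 0} ≥
        Nat.card {i : Fin n // (P i).1 = 0 ∧ 0 < (P i).2} +
          Nat.card {i : Fin n // P i = (xo, yo)}) :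
    -- correct prediction (consistency version)
    (CMP P (xo, yo) k = (0, 0) →
      ∃ (Q : Fin n → ℝ × ℝ) (oQ : ℝ × ℝ), (∀ y : ℝ × ℝ, Cu oQ Q ≤ Cu y Q) ∧
        Cu (CMP P (xo, yo) k) P / Cu (xo, yo) P <
          Cu (CMP Q oQ k) Q / Cu oQ Q) ∧
    -- prediction (0,0) (robustness version)
    (CMP P (0, 0) k = (0, 0) →
      ∃ Q : Fin n → ℝ × ℝ,
        Cu (CMP P (0, 0) k) P / (⨅ y : ℝ × ℝ, Cu y P) <
          Cu (CMP Q (0, 0) k) Q / ⨅ y : ℝ × ℝ, Cu y Q) := by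
  have hyo : 0 < yo := hxo.trans_le hxy
  have key : (CMP P (xo, yo) k = (0, 0) →
      ∃ (Q : Fin n → ℝ × ℝ) (q : ℝ × ℝ), (∀ y, Cu q Q ≤ Cu y Q) ∧
        CMP Q q k = (0, 0) ∧ Cu (0, 0) P / Cu (xo, yo) P < Cu (0, 0) Q / Cu q Q) ∧
      (CMP P (0, 0) k = (0, 0) →
      ∃ (Q : Fin n → ℝ × ℝ) (q : ℝ × ℝ), (∀ y, Cu q Q ≤ Cu y Q) ∧
        CMP Q (0, 0) k = (0, 0) ∧ Cu (0, 0) P / Cu (xo, yo) P < Cu (0, 0) Q / Cu q Q) := by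
    rcases hcount with hc | hc
    · exact exists_worse_profile hn k hxo hyo ho hall (sum_axisWeight_nonneg hc)
    · have swap_eq (p : ℝ × ℝ) : p.swap = (yo, xo) ↔ p = (xo, yo) := by
        simp [Prod.ext_iff, and_comm]
      obtain ⟨h1, h2⟩ := exists_worse_profile (P := fun i => (P i).swap) (o := (yo, xo)) hn k hyo hxo
        (fun y => (Cu_swap (xo, yo) P).trans_le ((ho y.swap).trans_eq (Cu_swap y.swap P).symm))
        (fun i => by
          have := hall i
          simp only [swap_eq, Prod.fst_swap, Prod.snd_swap]
          tauto)
        (sum_axisWeight_nonneg (by simpa only [swap_eq, Prod.fst_swap, Prod.snd_swap] using hc))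
      have e0 : Cu (0, 0) (fun i => (P i).swap) = Cu (0, 0) P := Cu_swap (0, 0) P
      have eo : Cu (yo, xo) (fun i => (P i).swap) = Cu (xo, yo) P := Cu_swap (xo, yo) P
      rw [e0, eo] at h1 h2
      have back {q : ℝ × ℝ} {Q : Fin n → ℝ × ℝ} (hq : ∀ y, Cu q Q ≤ Cu y Q) (y : ℝ × ℝ) :
          Cu q.swap (fun i => (Q i).swap) ≤ Cu y (fun i => (Q i).swap) :=
        (Cu_swap q Q).trans_le ((hq y.swap).trans_eq (Cu_swap y.swap Q).symm)
      refine ⟨fun h => ?_, fun h => ?_⟩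
      · obtain ⟨Q, q, hq, hQ, hlt⟩ := h1 ((CMP_swap P (xo, yo)).trans (congrArg Prod.swap h))
        refine ⟨fun i => (Q i).swap, q.swap, back hq,
          (CMP_swap Q q).trans (congrArg Prod.swap hQ), ?_⟩
        rwa [Cu_swap q Q, show Cu (0, 0) (fun i => (Q i).swap) = Cu (0, 0) Q from Cu_swap (0, 0) Q]
      · obtain ⟨Q, q, hq, hQ, hlt⟩ := h2 ((CMP_swap P (0, 0)).trans (congrArg Prod.swap h))
        refine ⟨fun i => (Q i).swap, q.swap, back hq,
          (CMP_swap Q (0, 0)).trans (congrArg Prod.swap hQ), ?_⟩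
        rwa [Cu_swap q Q, show Cu (0, 0) (fun i => (Q i).swap) = Cu (0, 0) Q from Cu_swap (0, 0) Q]
  refine ⟨fun h => ?_, fun h => ?_⟩
  · obtain ⟨Q, q, hq, hQ, hlt⟩ := key.1 h
    exact ⟨Q, q, hq, by rwa [h, hQ]⟩
  · obtain ⟨Q, q, hq, hQ, hlt⟩ := key.2 h
    exact ⟨Q, by rwa [h, hQ, iInf_Cu_eq ho, iInf_Cu_eq hq]⟩
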